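/- Let ε ≥ 0 and let S₁, S₂, S'₁, S'₂ be finite sets of pairs of real numbers. If S'₁ approximates S₁ with factor 1 + ε and S'₂ approximates S₂ with factor 1 + ε, then S'₁ + S'₂ approximates S₁ + S₂ with factor 1 + ε, and S'₁ ⊕ S'₂ approximates S₁ ⊕ S₂ with factor 1 + ε. -/

import Mathlib

open Pointwise
open scoped Classical

/-- `(w, p)` dominates `(w', p')`: `w ≤ w'`, `p ≥ p'`, at least one strict. -/
def dominates (a b : ℝ × ℝ) : Prop :=
  a.1 ≤ b.1 ∧ b.2 ≤ a.2 ∧ (a.1 < b.1 ∨ b.2 < a.2)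

/-- The `(max,+)`-convolution `X ⊕ Y`: the non-dominated tuples of the sumset `X + Y`. -/
noncomputable def maxPlusConv (X Y : Finset (ℝ × ℝ)) : Finset (ℝ × ℝ) :=
  (X + Y).filter fun t => ¬ ∃ t' ∈ X + Y, dominates t' t

/-- `S'` approximates `S` with factor `1 + ε`. -/
def ApproxFactorF (ε : ℝ) (S' S : Finset (ℝ × ℝ)) : Prop :=
  ∀ x ∈ S, ∃ y ∈ S', y.1 ≤ (1 + ε) * x.1 ∧ x.2 / (1 + ε) ≤ y.2

/-- Every tuple of a finite set is weakly dominated by a non-dominated tuple of that set. -/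
theorem exists_not_dominated_le (Z : Finset (ℝ × ℝ)) {y : ℝ × ℝ} (hy : y ∈ Z) :
    ∃ t ∈ Z, (¬ ∃ t' ∈ Z, dominates t' t) ∧ t.1 ≤ y.1 ∧ y.2 ≤ t.2 := by
  obtain ⟨t, ht, hmax⟩ := (Z.filter fun t => t.1 ≤ y.1 ∧ y.2 ≤ t.2).exists_max_image
    (fun t => t.2 - t.1) ⟨y, by simp [hy]⟩
  obtain ⟨htZ, htw, htp⟩ := Finset.mem_filter.mp ht
  refine ⟨t, htZ, ?_, htw, htp⟩
  rintro ⟨s, hs, hsw, hsp, hstrict⟩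
  have hle := hmax s (Finset.mem_filter.mpr ⟨hs, hsw.trans htw, htp.trans hsp⟩)
  rcases hstrict with h | h <;> linarith

/-- Approximation with a common factor is preserved by sumsets. -/
theorem ApproxFactorF.add {ε : ℝ} {S₁ S₂ S₁' S₂' : Finset (ℝ × ℝ)}
    (h1 : ApproxFactorF ε S₁' S₁) (h2 : ApproxFactorF ε S₂' S₂) :
    ApproxFactorF ε (S₁' + S₂') (S₁ + S₂) := by
  intro x hx
  obtain ⟨a, ha, b, hb, rfl⟩ := Finset.mem_add.mp hx
  obtain ⟨c, hc, hcw, hcp⟩ := h1 a ha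
  obtain ⟨d, hd, hdw, hdp⟩ := h2 b hb
  refine ⟨c + d, Finset.add_mem_add hc hd, ?_, ?_⟩
  · rw [Prod.fst_add, Prod.fst_add, mul_add]
    exact add_le_add hcw hdw
  · rw [Prod.snd_add, Prod.snd_add, add_div]
    exact add_le_add hcp hdp

theorem stmt_2 (ε : ℝ) (hε : 0 ≤ ε) (S₁ S₂ S₁' S₂' : Finset (ℝ × ℝ))
    (h1 : ApproxFactorF ε S₁' S₁) (h2 : ApproxFactorF ε S₂' S₂) :
    ApproxFactorF ε (S₁' + S₂') (S₁ + S₂) ∧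
    ApproxFactorF ε (maxPlusConv S₁' S₂') (maxPlusConv S₁ S₂) := by
  refine ⟨h1.add h2, fun x hx => ?_⟩
  obtain ⟨y, hy, hyw, hyp⟩ := h1.add h2 x (Finset.mem_filter.mp hx).1
  obtain ⟨t, ht, hnd, htw, htp⟩ := exists_not_dominated_le _ hy
  exact ⟨t, Finset.mem_filter.mpr ⟨ht, hnd⟩, htw.trans hyw, hyp.trans htp⟩
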